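/- Let M be an n×m matrix with strictly positive entries and α ∈ ℝ^n a vector with strictly positive entries. Set u = min(α/(M𝟙_m), 𝟙_n) entrywise and P = diag(u)·M. Then P belongs to C₁ = {Q ∈ ℝ^{n×m} : Q_{ij} ≥ 0, (Q𝟙_m)_i ≤ α_i for all i}, and for every Q ∈ C₁, KL(Q|M) ≥ KL(P|M), where KL is the generalized Kullback–Leibler divergence. That is, diag(min(α/(M𝟙_m), 𝟙_n))·M is the KL projection of M onto C₁. -/

import Mathlib

open Finset

theorem tangent_le_mul_log_div {q c u : ℝ} (hq : 0 ≤ q) (hc : 0 < c) (hu : 0 < u) :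
    u * c * Real.log (u * c / c) - u * c + c + Real.log u * (q - u * c)
      ≤ q * Real.log (q / c) - q + c := by
  rw [mul_div_cancel_right₀ u hc.ne']
  rcases hq.eq_or_lt with rfl | hq
  · have := mul_pos hu hc
    simp only [zero_div, Real.log_zero, mul_zero]
    linarith
  · have h := mul_le_mul_of_nonneg_left
      (Real.log_le_sub_one_of_pos (div_pos (mul_pos hu hc) hq)) hq.le
    rw [Real.log_div (mul_pos hu hc).ne' hq.ne', Real.log_mul hu.ne' hc.ne', mul_sub q (_ / q),
      mul_div_cancel₀ _ hq.ne'] at h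
    rw [Real.log_div hq.ne' hc.ne']
    linarith

/-- For a positive matrix `M` and a positive vector `α`, the matrix
`P = diag(min(α/(M𝟙_m), 𝟙_n))·M` belongs to
`C₁ = {Q : Q ≥ 0, Q𝟙_m ≤ α}` and minimizes the generalized KL divergence
`KL(·|M) = Σ_{ij} (Q_{ij} log(Q_{ij}/M_{ij}) − Q_{ij} + M_{ij})` over `C₁`;
i.e. `P` is the KL projection of `M` onto `C₁`. -/
theorem KL_projection_row_constraint
    (n m : ℕ) (M : Matrix (Fin n) (Fin m) ℝ) (hM : ∀ i j, 0 < M i j)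
    (α : Fin n → ℝ) (hα : ∀ i, 0 < α i)
    (u : Fin n → ℝ) (hu : ∀ i, u i = min (α i / ∑ j, M i j) 1)
    (P : Matrix (Fin n) (Fin m) ℝ) (hP : ∀ i j, P i j = u i * M i j) :
    ((∀ i j, 0 ≤ P i j) ∧ (∀ i, ∑ j, P i j ≤ α i)) ∧
    (∀ Q : Matrix (Fin n) (Fin m) ℝ,
      (∀ i j, 0 ≤ Q i j) → (∀ i, ∑ j, Q i j ≤ α i) →
      (∑ i, ∑ j, (P i j * Real.log (P i j / M i j) - P i j + M i j))
        ≤ ∑ i, ∑ j, (Q i j * Real.log (Q i j / M i j) - Q i j + M i j)) := by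
  rcases m.eq_zero_or_pos with rfl | hm
  · exact ⟨⟨fun _ j => j.elim0, fun i => by simpa using (hα i).le⟩, fun Q _ _ => by simp⟩
  have : Nonempty (Fin m) := ⟨⟨0, hm⟩⟩
  have hS : ∀ i, 0 < ∑ j, M i j := fun i => sum_pos (fun j _ => hM i j) univ_nonempty
  have hu_pos : ∀ i, 0 < u i := fun i => by
    rw [hu]; exact lt_min (div_pos (hα i) (hS i)) one_pos
  have hrow : ∀ i, ∑ j, P i j = u i * ∑ j, M i j := fun i => by
    simp only [hP, mul_sum]
  refine ⟨⟨fun i j => ?_, fun i => ?_⟩, fun Q hQ hQα => sum_le_sum fun i _ => ?_⟩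
  · rw [hP]; exact (mul_pos (hu_pos i) (hM i j)).le
  · rw [hrow, ← le_div_iff₀ (hS i), hu]
    exact min_le_left _ _
  · have hslack : 0 ≤ Real.log (u i) * ∑ j, (Q i j - P i j) := by
      rw [sum_sub_distrib, hrow]
      rcases le_total (α i / ∑ j, M i j) 1 with h | h
      · have hui : u i = α i / ∑ j, M i j := by rw [hu, min_eq_left h]
        refine mul_nonneg_of_nonpos_of_nonpos
          (Real.log_nonpos (hu_pos i).le (hui.trans_le h)) ?_
        rw [hui, div_mul_cancel₀ _ (hS i).ne']
        exact sub_nonpos.2 (hQα i)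
      · rw [hu, min_eq_right h, Real.log_one, zero_mul]
    refine (le_add_of_nonneg_right hslack).trans ?_
    rw [mul_sum, ← sum_add_distrib]
    refine sum_le_sum fun j _ => ?_
    rw [hP]
    exact tangent_le_mul_log_div (hQ i j) (hM i j) (hu_pos i)
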